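/- arXiv:2508.17375 — 6 statements merged into one kernel-verified Lean document; each statement's English description precedes it below -/
import Mathlib

section
/- Suppose every transaction in the batch satisfies Rule 1, i.e., for all i j : Fin n with j < i we have R i ∩ W j = ∅ (no transaction has a RAW dependency on an earlier transaction). Then every conflict edge respects transaction-ID order — d a b implies a < b — and consequently the conflict relation d is acyclic: for every v : Fin n, ¬ Relation.TransGen d v v. Hence the batch execution is conflict-serializable, with the TID order serving as a serialization order. -/
/-- If every transaction satisfies Rule 1 (no RAW dependency on an
earlier transaction, i.e. `R i ∩ W j = ∅` whenever `j < i`), then every conflict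
edge of the batch respects transaction-ID order (`d a b → a < b`) and the
conflict relation `d` is acyclic, hence the batch is conflict-serializable with
the TID order as serialization order. -/
theorem foresight_rule1_serializable {n : ℕ} {K : Type*}
    (R W : Fin n → Set K) (d : Fin n → Fin n → Prop)
    (hd : ∀ a b : Fin n,
      d a b ↔ a ≠ b ∧ ((R a ∩ W b).Nonempty ∨ ((W a ∩ W b).Nonempty ∧ a < b)))
    (hrule1 : ∀ i j : Fin n, j < i → R i ∩ W j = ∅) :
    (∀ a b : Fin n, d a b → a < b) ∧
      ∀ v : Fin n, ¬ Relation.TransGen d v v := by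
  have edge_lt : ∀ a b : Fin n, d a b → a < b := by
    intro a b hab
    obtain ⟨hne, hread | ⟨-, hlt⟩⟩ := (hd a b).mp hab
    · refine lt_of_le_of_ne (le_of_not_gt fun hba => ?_) hne
      exact hread.ne_empty (hrule1 a b hba)
    · exact hlt
  refine ⟨edge_lt, fun v hv => lt_irrefl v ?_⟩
  exact Relation.transGen_minimal (r' := (· < ·)) edge_lt v v hv
end

section
/- Suppose every transaction in the batch satisfies Rule 2: for each i : Fin n, either (∀ j < i, R i ∩ W j = ∅) (no RAW dependency on an earlier transaction) or (∀ j ≠ i, W i ∩ W j = ∅ ∧ W i ∩ R j = ∅) (no WAW and no WAR dependency with any other transaction in the batch). Then the conflict relation d is acyclic: for every v : Fin n, ¬ Relation.TransGen d v v. Hence the reordered batch execution, in which RAW dependencies are transformed into WAR dependencies by placing readers before writers, is conflict-serializable. -/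
/-- If every transaction satisfies Rule 2 (either no RAW dependency
on an earlier transaction, or no WAW and no WAR dependency with any other
transaction in the batch), then the conflict relation `d` is acyclic, hence the
reordered batch execution is conflict-serializable. -/
theorem foresight_rule2_serializable {n : ℕ} {K : Type*}
    (R W : Fin n → Set K) (d : Fin n → Fin n → Prop)
    (hd : ∀ a b : Fin n,
      d a b ↔ a ≠ b ∧ ((R a ∩ W b).Nonempty ∨ ((W a ∩ W b).Nonempty ∧ a < b)))
    (hrule2 : ∀ i : Fin n,
      (∀ j : Fin n, j < i → R i ∩ W j = ∅) ∨
      (∀ j : Fin n, j ≠ i → W i ∩ W j = ∅ ∧ W i ∩ R j = ∅)) :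
    ∀ v : Fin n, ¬ Relation.TransGen d v v := by
  have no_raw_of_edge : ∀ a b, d a b → ∀ j, j < b → R b ∩ W j = ∅ := by
    intro a b hab
    obtain ⟨hne, hconf⟩ := (hd a b).1 hab
    refine (hrule2 b).resolve_right fun h => ?_
    obtain ⟨hWW, hWR⟩ := h a hne
    rw [Set.inter_comm] at hWW hWR
    rcases hconf with h | ⟨h, -⟩
    · exact h.ne_empty hWR
    · exact h.ne_empty hWW
  have lt_of_edge : ∀ a b, (∀ j, j < a → R a ∩ W j = ∅) → d a b → a < b := by
    intro a b ha hab
    obtain ⟨hne, h | ⟨-, h⟩⟩ := (hd a b).1 hab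
    · exact lt_of_le_of_ne (not_lt.1 fun hlt => h.ne_empty (ha b hlt)) hne
    · exact h
  intro v hv
  obtain ⟨u, -, huv⟩ := Relation.TransGen.tail'_iff.1 hv
  have lt_of_path : ∀ b, Relation.TransGen d v b → v < b := by
    intro b hb
    induction hb with
    | single h => exact lt_of_edge _ _ (no_raw_of_edge _ _ huv) h
    | tail hvb hbc ih =>
      obtain ⟨w, -, hw⟩ := Relation.TransGen.tail'_iff.1 hvb
      exact ih.trans (lt_of_edge _ _ (no_raw_of_edge _ _ hw) hbc)
  exact lt_irrefl v (lt_of_path v hv)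
end

section
/- Assume that for every s-edge (a, b), either a ∈ S, or b ∈ S, or there is no directed path in the residual graph from b back to a, i.e., ¬ Relation.ReflTransGen r' b a. Then the residual graph is acyclic: for every v : V, ¬ Relation.TransGen r' v v. In other words, aborting a vertex set S that hits (or whose removal destroys) every path closing a RAW edge into a cycle breaks all dependency cycles; this is the correctness of Rule 3 and of MTFS's abort-set (feedback-vertex-set) extraction. -/
/-- A rank that increases along every edge lying on a cycle increases along every path lying on
a cycle. -/
theorem Relation.TransGen.rank_lt_of_reflTransGen {V : Type*} {r : V → V → Prop} {f : V → ℕ}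
    (hr : ∀ a b, r a b → Relation.ReflTransGen r b a → f a < f b) {a b : V}
    (hab : Relation.TransGen r a b) (hba : Relation.ReflTransGen r b a) : f a < f b := by
  induction hab with
  | single h => exact hr _ _ h hba
  | tail hab hbc ih =>
    exact (ih (hba.head hbc)).trans (hr _ _ hbc (hba.trans hab.to_reflTransGen))

/-- Correctness of Rule 3 / MTFS abort-set extraction: if the abort
set `S` hits (or whose removal destroys) every residual path closing a RAW edge
`s a b` into a cycle, then the residual graph `r'` (after removing `S`) is acyclic. -/
theorem foresight_rule3_abort_set_breaks_cycles {V : Type*}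
    (r₀ s : V → V → Prop) (f : V → ℕ)
    (hrank : ∀ a b : V, r₀ a b → f a < f b)
    (S : Set V) (r' : V → V → Prop)
    (hr' : ∀ a b : V, r' a b ↔ (r₀ a b ∨ s a b) ∧ a ∉ S ∧ b ∉ S)
    (habort : ∀ a b : V, s a b → a ∈ S ∨ b ∈ S ∨ ¬ Relation.ReflTransGen r' b a) :
    ∀ v : V, ¬ Relation.TransGen r' v v := by
  intro v hv
  refine lt_irrefl (f v) (hv.rank_lt_of_reflTransGen (fun a b hab hba => ?_) .refl)
  obtain ⟨h | h, ha, hb⟩ := (hr' a b).1 hab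
  · exact hrank a b h
  · rcases habort a b h with h | h | h
    · exact absurd h ha
    · exact absurd h hb
    · exact absurd hba h
end

section
/- If dependencies point only to earlier transactions, i.e., r i j → j < i for all i j : Fin n, then for all i j : Fin n, M i j ≠ 0 ↔ Relation.ReflTransGen r i j. That is, M i j = 0 exactly when no dependency path (direct or indirect) from T_i to T_j exists, and M i j ≥ 1 exactly when some dependency path exists. -/
theorem pow_succ_apply_ne_zero_iff {ι : Type*} [Fintype ι] [DecidableEq ι]
    (r : ι → ι → Prop) [DecidableRel r] (A : Matrix ι ι ℕ)
    (hA : ∀ i j, A i j = if r i j then 1 else 0) (k : ℕ) (i j : ι) :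
    (A ^ (k + 1)) i j ≠ 0 ↔ ∃ b, (A ^ k) i b ≠ 0 ∧ r b j := by
  simp [pow_succ, Matrix.mul_apply, hA, and_comm]

theorem reflTransGen_of_pow_apply_ne_zero {ι : Type*} [Fintype ι] [DecidableEq ι]
    (r : ι → ι → Prop) [DecidableRel r] (A : Matrix ι ι ℕ)
    (hA : ∀ i j, A i j = if r i j then 1 else 0) (k : ℕ) (i j : ι)
    (h : (A ^ k) i j ≠ 0) : Relation.ReflTransGen r i j := by
  induction k generalizing j with
  | zero =>
    obtain rfl : i = j := by
      by_contra hij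
      exact h (by simp [hij])
    exact .refl
  | succ k ih =>
    obtain ⟨b, hb, hr⟩ := (pow_succ_apply_ne_zero_iff r A hA k i j).1 h
    exact (ih b hb).tail hr

/-- When every step of `r` decreases the index, a path from `i` to `j` has length at most
`i - j`. -/
theorem exists_pow_apply_ne_zero_of_reflTransGen {n : ℕ} (r : Fin n → Fin n → Prop)
    [DecidableRel r] (A : Matrix (Fin n) (Fin n) ℕ)
    (hA : ∀ i j, A i j = if r i j then 1 else 0) (hlt : ∀ i j, r i j → j < i)
    {i j : Fin n} (h : Relation.ReflTransGen r i j) :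
    ∃ k : ℕ, k + (j : ℕ) ≤ i ∧ (A ^ k) i j ≠ 0 := by
  induction h with
  | refl => exact ⟨0, by simp⟩
  | @tail b c _ hr ih =>
    obtain ⟨k, hk, hne⟩ := ih
    have hcb : (c : ℕ) < b := hlt b c hr
    exact ⟨k + 1, by omega, (pow_succ_apply_ne_zero_iff r A hA k i c).2 ⟨b, hne, hr⟩⟩

/-- If direct dependencies point only to earlier transactions,
then the MTFS dependency matrix `M = ∑ k < n, A ^ k` has `M i j ≠ 0` exactly when
there is a dependency path (direct or indirect, possibly empty) from `T_i` to `T_j`. -/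
theorem mtfs_matrix_nonzero_iff_path {n : ℕ} (r : Fin n → Fin n → Prop)
    [DecidableRel r]
    (A : Matrix (Fin n) (Fin n) ℕ)
    (hA : ∀ i j : Fin n, A i j = if r i j then 1 else 0)
    (M : Matrix (Fin n) (Fin n) ℕ)
    (hM : M = ∑ k ∈ Finset.range n, A ^ k)
    (hlt : ∀ i j : Fin n, r i j → j < i) :
    ∀ i j : Fin n, M i j ≠ 0 ↔ Relation.ReflTransGen r i j := by
  intro i j
  have hsum : M i j ≠ 0 ↔ ∃ k < n, (A ^ k) i j ≠ 0 := by
    simp [hM, Matrix.sum_apply]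
  rw [hsum]
  constructor
  · rintro ⟨k, -, hk⟩
    exact reflTransGen_of_pow_apply_ne_zero r A hA k i j hk
  · intro h
    obtain ⟨k, hk, hne⟩ := exists_pow_apply_ne_zero_of_reflTransGen r A hA hlt h
    exact ⟨k, by omega, hne⟩
end

section
/- If dependencies point only to earlier transactions, i.e., r i j → j < i for all i j : Fin n, then for all i j : Fin n the set of directed r-walks from i to j (finite sequences i = v₀, v₁, …, v_m = j with r v_t v_{t+1} for every t < m) is finite, and the dependency-matrix entry M i j equals its cardinality. Thus M i j records the exact number of distinct dependency paths from T_i to T_j, capturing both direct and indirect dependencies. -/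
/-- The type of directed `r`-walks from `i` to `j`: finite sequences
`i = v₀, v₁, …, v_m = j` with `r v_t v_{t+1}` for every `t < m`. -/
def DepWalk (n : ℕ) (r : Fin n → Fin n → Prop) (i j : Fin n) : Type :=
  Σ m : ℕ, {p : Fin (m + 1) → Fin n //
    p 0 = i ∧ p (Fin.last m) = j ∧
      ∀ t : Fin m, r (p t.castSucc) (p t.succ)}

/-- The type of directed `r`-walks of length `m` from `i` to `j`. -/
abbrev DepWalkOfLength {n : ℕ} (r : Fin n → Fin n → Prop) (m : ℕ) (i j : Fin n) : Type :=
  {p : Fin (m + 1) → Fin n //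
    p 0 = i ∧ p (Fin.last m) = j ∧ ∀ t : Fin m, r (p t.castSucc) (p t.succ)}

/-- A walk of length `m + 1` is a first step followed by a walk of length `m`. -/
def DepWalkOfLength.succEquiv {n : ℕ} (r : Fin n → Fin n → Prop) (m : ℕ) (i j : Fin n) :
    DepWalkOfLength r (m + 1) i j ≃ Σ k : Fin n, {_p : DepWalkOfLength r m k j // r i k} where
  toFun p := ⟨p.1 1, ⟨⟨Fin.tail p.1, rfl, p.2.2.1, fun t => p.2.2.2 t.succ⟩, by
    have h := p.2.2.2 0
    rwa [Fin.castSucc_zero, p.2.1] at h⟩⟩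
  invFun q := ⟨Fin.cons i q.2.1.1, rfl, q.2.1.2.2.1, by
    intro t
    refine Fin.cases ?_ (fun t => ?_) t
    · change r i (q.2.1.1 0)
      rw [q.2.1.2.1]
      exact q.2.2
    · exact q.2.1.2.2.2 t⟩
  left_inv := by
    rintro ⟨p, rfl, hj, hp⟩
    exact Subtype.ext (Fin.cons_self_tail p)
  right_inv := by
    rintro ⟨k, ⟨⟨p, rfl, hj, hp⟩, hr⟩⟩
    rfl

theorem DepWalkOfLength.pow_apply_eq_card {n : ℕ} (r : Fin n → Fin n → Prop) [DecidableRel r]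
    (A : Matrix (Fin n) (Fin n) ℕ) (hA : ∀ i j : Fin n, A i j = if r i j then 1 else 0)
    (m : ℕ) (i j : Fin n) : (A ^ m) i j = Nat.card (DepWalkOfLength r m i j) := by
  induction m generalizing i with
  | zero =>
    rw [pow_zero, Matrix.one_apply]
    split_ifs with h
    · subst h
      symm
      rw [Nat.card_eq_one_iff_unique]
      refine ⟨⟨fun p q => Subtype.ext (funext fun t => ?_)⟩,
        ⟨⟨fun _ => i, rfl, rfl, fun t => t.elim0⟩⟩⟩
      obtain rfl : t = 0 := Fin.fin_one_eq_zero t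
      exact p.2.1.trans q.2.1.symm
    · symm
      have : IsEmpty (DepWalkOfLength r 0 i j) := ⟨fun p => h (p.2.1.symm.trans p.2.2.1)⟩
      exact Nat.card_of_isEmpty
  | succ m ih =>
    rw [pow_succ', Matrix.mul_apply, Nat.card_congr (succEquiv r m i j), Nat.card_sigma]
    refine Finset.sum_congr rfl fun k _ => ?_
    rw [hA, ih]
    split_ifs with h
    · rw [one_mul]
      exact Nat.card_congr (Equiv.subtypeUnivEquiv fun _ => h).symm
    · rw [zero_mul]
      have : IsEmpty {_p : DepWalkOfLength r m k j // r i k} := ⟨fun p => h p.2⟩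
      exact Nat.card_of_isEmpty.symm

theorem DepWalkOfLength.length_lt {n : ℕ} {r : Fin n → Fin n → Prop}
    (hlt : ∀ i j : Fin n, r i j → j < i) {m : ℕ} {i j : Fin n}
    (p : DepWalkOfLength r m i j) : m < n := by
  have hanti : StrictAnti p.1 := Fin.strictAnti_iff_succ_lt.2 fun t => hlt _ _ (p.2.2.2 t)
  simpa using Fintype.card_le_of_injective p.1 hanti.injective

/-- When dependencies point to earlier transactions, every walk has length less than `n`. -/
def DepWalk.equivSigmaFin {n : ℕ} {r : Fin n → Fin n → Prop}
    (hlt : ∀ i j : Fin n, r i j → j < i) (i j : Fin n) :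
    DepWalk n r i j ≃ Σ m : Fin n, DepWalkOfLength r m i j where
  toFun w := ⟨⟨w.1, DepWalkOfLength.length_lt hlt w.2⟩, w.2⟩
  invFun w := ⟨w.1, w.2⟩
  left_inv _ := rfl
  right_inv _ := rfl

/-- If dependencies point only to earlier transactions, then the
set of directed `r`-walks from `i` to `j` is finite, and the dependency-matrix
entry `M i j` equals its cardinality: `M i j` counts the exact number of distinct
dependency paths from `T_i` to `T_j`, direct and indirect. -/
theorem mtfs_matrix_counts_all_paths {n : ℕ} (r : Fin n → Fin n → Prop)
    [DecidableRel r]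
    (A : Matrix (Fin n) (Fin n) ℕ)
    (hA : ∀ i j : Fin n, A i j = if r i j then 1 else 0)
    (M : Matrix (Fin n) (Fin n) ℕ)
    (hM : M = ∑ k ∈ Finset.range n, A ^ k)
    (hlt : ∀ i j : Fin n, r i j → j < i) (i j : Fin n) :
    Finite (DepWalk n r i j) ∧ M i j = Nat.card (DepWalk n r i j) := by
  have e := DepWalk.equivSigmaFin hlt i j
  refine ⟨Finite.of_equiv _ e.symm, ?_⟩
  rw [Nat.card_congr e, Nat.card_sigma, hM, Matrix.sum_apply, Finset.sum_range]
  exact Finset.sum_congr rfl fun m _ => DepWalkOfLength.pow_apply_eq_card r A hA m i j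
end

section
/- Let (Ω, μ) be a probability space and let A, B, C be measurable events that are mutually independent (A is the event that transaction T_i has a RAW dependency on a preceding transaction, B that it has a WAR dependency, and C that it has a WAW dependency). Under Rule 2, T_i commits exactly on the event (A ∩ (B ∪ C))ᶜ, i.e., unless it has a RAW dependency together with a WAR or WAW dependency. Then the commit probability satisfies μ.real ((A ∩ (B ∪ C))ᶜ) = 1 − (1 − μ.real Aᶜ) · (1 − μ.real Bᶜ · μ.real Cᶜ); writing Pr[¬RAW_i] = μ.real Aᶜ, Pr[¬WAR_i] = μ.real Bᶜ, Pr[¬WAW_i] = μ.real Cᶜ, this is the paper's formula Pr[T_i] = 1 − (1 − Pr[¬RAW_i]) · (1 − Pr[¬WAR_i] · Pr[¬WAW_i]). -/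
open MeasureTheory ProbabilityTheory

/-- For mutually independent events `A` (RAW), `B` (WAR), `C`
(WAW) on a probability space, the Rule-2 commit event `(A ∩ (B ∪ C))ᶜ` has
probability `1 − (1 − Pr[¬RAW])·(1 − Pr[¬WAR]·Pr[¬WAW])`, i.e. the paper's
formula `Pr[T_i] = 1 − (1 − Pr[¬RAW_i])·(1 − Pr[¬WAR_i]·Pr[¬WAW_i])`.
(Here `μ.real s` is rendered as `(μ s).toReal`.) -/
theorem rule2_commit_probability {Ω : Type*} [MeasurableSpace Ω]
    (μ : Measure Ω) [IsProbabilityMeasure μ] (A B C : Set Ω)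
    (hA : MeasurableSet A) (hB : MeasurableSet B) (hC : MeasurableSet C)
    (hindep : iIndepSet ![A, B, C] μ) :
    (μ ((A ∩ (B ∪ C))ᶜ)).toReal =
      1 - (1 - (μ Aᶜ).toReal) * (1 - (μ Bᶜ).toReal * (μ Cᶜ).toReal) := by
  have hmeas : ∀ s : Set Ω, MeasurableSet[MeasurableSpace.generateFrom {s}] s :=
    fun s ↦ MeasurableSpace.measurableSet_generateFrom rfl
  have hABC : μ (A ∩ (Bᶜ ∩ Cᶜ)) = μ A * (μ Bᶜ * μ Cᶜ) := by
    have h := (iIndepSet_iff _ _).1 hindep Finset.univ (f := ![A, Bᶜ, Cᶜ]) (by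
      intro i _
      fin_cases i
      · exact hmeas A
      · exact (hmeas B).compl
      · exact (hmeas C).compl)
    have hset : ⋂ i ∈ (Finset.univ : Finset (Fin 3)), (![A, Bᶜ, Cᶜ] : Fin 3 → Set Ω) i =
        A ∩ (Bᶜ ∩ Cᶜ) := by
      ext x
      simp [Fin.forall_fin_succ]
    rw [hset] at h
    simpa [Fin.prod_univ_three, mul_assoc] using h
  have hreal : μ.real (A ∩ (B ∪ C)ᶜ) = μ.real A * (μ.real Bᶜ * μ.real Cᶜ) := by
    rw [Set.compl_union]
    simp only [Measure.real, hABC, ENNReal.toReal_mul]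
  have hsplit := measureReal_inter_add_sdiff (μ := μ) (s := A) (hB.union hC)
  rw [Set.sdiff_eq, hreal] at hsplit
  have hcompl := probReal_compl_eq_one_sub (μ := μ) (hA.inter (hB.union hC))
  have hcomplA := probReal_compl_eq_one_sub (μ := μ) hA
  change μ.real _ = 1 - (1 - μ.real _) * (1 - μ.real _ * μ.real _)
  rw [hcompl, hcomplA]
  linear_combination -hsplit
end
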